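/- Suppose E ⊆ 𝔽_7^3 is a spectral set with |E| = 21, and suppose there are two distinct two-dimensional subspaces P₁ and P₂ of 𝔽_7^3 such that E determines at most two of the one-dimensional subspaces contained in P₁ and at most two of the one-dimensional subspaces contained in P₂. Then E is contained in the union of seven parallel lines; that is, there exist a one-dimensional subspace d of 𝔽_7^3 and seven cosets of d whose union contains E. -/

import Mathlib

open Finset

/-- The character `x ↦ e^{2πi (x·a)/p}` on `𝔽_p^d`. -/
noncomputable def chr (p : ℕ) {d : ℕ} (a x : Fin d → ZMod p) : ℂ :=
  Complex.exp (2 * (Real.pi : ℂ) * Complex.I *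
    ((ZMod.val (∑ i, x i * a i) : ℕ) : ℂ) / (p : ℂ))

/-- `(E, A)` is a spectral pair: the characters `χ_a`, `a ∈ A`, restricted to `E`,
are pairwise orthogonal, span `L²(E)`, and are linearly independent, i.e. they
form an orthogonal basis of `L²(E)`. -/
def IsSpectralPair (p : ℕ) {d : ℕ} (E A : Finset (Fin d → ZMod p)) : Prop :=
  (∀ a ∈ A, ∀ b ∈ A, a ≠ b →
    ∑ x ∈ E, chr p a x * (starRingEnd ℂ) (chr p b x) = 0) ∧
  (∀ f : E → ℂ, ∃ c : A → ℂ, ∀ x : E, f x = ∑ a : A, c a * chr p a.1 x.1) ∧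
  (∀ c : A → ℂ, (∀ x : E, ∑ a : A, c a * chr p a.1 x.1 = 0) → ∀ a, c a = 0)

/-- `E` is a spectral set. -/
def IsSpectral (p : ℕ) {d : ℕ} (E : Finset (Fin d → ZMod p)) : Prop :=
  ∃ A, IsSpectralPair p E A

/-- `E` tiles `𝔽_p^d` by translation. -/
def Tiles (p : ℕ) {d : ℕ} (E : Finset (Fin d → ZMod p)) : Prop :=
  ∃ A : Finset (Fin d → ZMod p),
    ∀ x, (∑ a ∈ A, if x - a ∈ E then (1 : ℕ) else 0) = 1

/-- `E` determines the direction (one-dimensional subspace) `D`. -/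
def Determines (p : ℕ) {d : ℕ} (E : Finset (Fin d → ZMod p))
    (D : Submodule (ZMod p) (Fin d → ZMod p)) : Prop :=
  ∃ e₁ ∈ E, ∃ e₂ ∈ E, e₁ ≠ e₂ ∧ e₁ - e₂ ∈ D

/-- The Fourier transform of the indicator function of `E`. -/
noncomputable def ftE (p : ℕ) {d : ℕ} (E : Finset (Fin d → ZMod p))
    (ξ : Fin d → ZMod p) : ℂ :=
  ((p : ℂ) ^ d)⁻¹ * ∑ x ∈ E, Complex.exp (-(2 * (Real.pi : ℂ) * Complex.I *
    ((ZMod.val (∑ i, x i * ξ i) : ℕ) : ℂ) / (p : ℂ)))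

/-- The orthogonal set `S^⊥ = {x : x · y = 0 for all y ∈ S}`. -/
def perpSet (p : ℕ) {d : ℕ} (S : Submodule (ZMod p) (Fin d → ZMod p)) :
    Set (Fin d → ZMod p) :=
  {x | ∀ y ∈ S, ∑ i, x i * y i = 0}



theorem num_local (x y e O sx sy Lx Ly : ℤ) (hx : 1 ≤ x) (hy : 1 ≤ y) (hex : x ≤ e) (hey : y ≤ e)
    (hexy : e ≤ x * y) (hO : e + O ≤ 7) (hO0 : 0 ≤ O) (hs : x + y - (sx + sy) ≤ O) (hsx : sx ≤ x) (hsy : sy ≤ y)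
    (hsx0 : 0 ≤ sx) (hsy0 : 0 ≤ sy)
    (hLx : Lx ≤ sx * y) (hLy : Ly ≤ sy * x) :
    30 * e ≤ 37 * (x + y) - 10 * e - 5 * O + 37 * (sx + sy) - 5 * (Lx + Ly) := by
  have h1 : x ≤ 7 := by omega
  have h2 : y ≤ 7 := by omega
  interval_cases x <;> interval_cases y <;> omega

/-- one side of the local sum -/
theorem side_sum {ι : Type*} [DecidableEq ι] (X : Finset ι) (din o : ι → ℕ) (y : ℕ)
    (hy : ∀ h ∈ X, din h ≤ y) (h1 : ∀ h ∈ X, 1 ≤ din h) :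
    ∃ s L : ℤ, 0 ≤ s ∧ s ≤ X.card ∧ L ≤ s * y ∧ (X.card : ℤ) - s ≤ ∑ h ∈ X, (o h : ℤ) ∧
      ∑ h ∈ X, (if o h = 0 then 2 else 1) * (37 - 5 * ((din h : ℤ) + o h)) =
        37 * X.card - 5 * ∑ h ∈ X, (din h : ℤ) - 5 * ∑ h ∈ X, (o h : ℤ) + 37 * s - 5 * L := by
  induction X using Finset.induction_on with
  | empty => exact ⟨0, 0, by simp⟩
  | insert a X ha ih =>
    obtain ⟨s, L, hs0, hsX, hL, hsO, heq⟩ := ih (fun h hh => hy h (mem_insert_of_mem hh))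
      (fun h hh => h1 h (mem_insert_of_mem hh))
    have hya := hy a (mem_insert_self _ _)
    by_cases h0 : o a = 0
    · refine ⟨s + 1, L + din a, by omega, ?_, ?_, ?_, ?_⟩
      · rw [card_insert_of_notMem ha]; push_cast; omega
      · have : (din a : ℤ) ≤ y := by exact_mod_cast hya
        linarith
      · rw [card_insert_of_notMem ha, sum_insert ha]; push_cast; omega
      · rw [card_insert_of_notMem ha, sum_insert ha, sum_insert ha, sum_insert ha, heq]
        simp [h0]; ring
    · refine ⟨s, L, by omega, ?_, hL, ?_, ?_⟩
      · rw [card_insert_of_notMem ha]; push_cast; omega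
      · rw [card_insert_of_notMem ha, sum_insert ha]; push_cast; omega
      · rw [card_insert_of_notMem ha, sum_insert ha, sum_insert ha, sum_insert ha, heq]
        simp [h0]; ring

/-- number of points of `E` in half row `h` -/
def din {V : Type*} (E : Finset V) (f : V → ZMod 7 × Bool) (h : ZMod 7 × Bool) : ℕ :=
  (E.filter (fun e => f e = h)).card

def wF {V : Type*} (E : Finset V) (f : V → ZMod 7 × Bool) (h : ZMod 7 × Bool) : ℤ :=
  (if din E f (h.1, !h.2) = 0 then 2 else 1) * (37 - 5 * ((din E f h : ℤ) + din E f (h.1, !h.2)))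

theorem local_ineq {V : Type*} [DecidableEq V] (E K : Finset V) (i j : V → ZMod 7) (ρ κ : ZMod 7 → Bool)
    (hKE : K ⊆ E) (hne : K.Nonempty) (b c : Bool)
    (hb : ∀ e ∈ K, ρ (i e) = b) (hc : ∀ e ∈ K, κ (j e) = c)
    (hinj : ∀ e ∈ E, ∀ e' ∈ E, i e = i e' → j e = j e' → e = e')
    (hrow : ∀ e ∈ K, ∀ e' ∈ E, i e' = i e → κ (j e') = c → e' ∈ K)
    (hcol : ∀ e ∈ K, ∀ e' ∈ E, j e' = j e → ρ (i e') = b → e' ∈ K)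
    (h7 : (E.filter (fun e => ∃ e' ∈ K, i e = i e' ∨ j e = j e')).card ≤ 7) :
    30 * (K.card : ℤ) ≤ ∑ h ∈ K.image (fun e => (i e, κ (j e))), wF E (fun e => (i e, κ (j e))) h
      + ∑ h ∈ K.image (fun e => (j e, ρ (i e))), wF E (fun e => (j e, ρ (i e))) h := by
  set f : V → ZMod 7 × Bool := fun e => (i e, κ (j e)) with hf
  set g : V → ZMod 7 × Bool := fun e => (j e, ρ (i e)) with hg
  set X := K.image f with hX
  set Y := K.image g with hY
  have fibf : ∀ h ∈ X, E.filter (fun e => f e = h) = K.filter (fun e => f e = h) := by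
    intro h hh
    obtain ⟨e0, he0, rfl⟩ := mem_image.1 hh
    ext e
    simp only [mem_filter]
    constructor
    · rintro ⟨he, h1⟩
      simp only [hf, Prod.mk.injEq] at h1
      exact ⟨hrow e0 he0 e he h1.1 (h1.2.trans (hc _ he0)), by simp [hf, h1]⟩
    · rintro ⟨he, h1⟩
      exact ⟨hKE he, h1⟩
  have fibg : ∀ h ∈ Y, E.filter (fun e => g e = h) = K.filter (fun e => g e = h) := by
    intro h hh
    obtain ⟨e0, he0, rfl⟩ := mem_image.1 hh
    ext e
    simp only [mem_filter]
    constructor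
    · rintro ⟨he, h1⟩
      simp only [hg, Prod.mk.injEq] at h1
      exact ⟨hcol e0 he0 e he h1.1 (h1.2.trans (hb _ he0)), by simp [hg, h1]⟩
    · rintro ⟨he, h1⟩
      exact ⟨hKE he, h1⟩
  have sumf : ∑ h ∈ X, din E f h = K.card := by
    rw [card_eq_sum_card_image f K]
    exact sum_congr rfl (fun h hh => by rw [din, fibf h hh])
  have sumg : ∑ h ∈ Y, din E g h = K.card := by
    rw [card_eq_sum_card_image g K]
    exact sum_congr rfl (fun h hh => by rw [din, fibg h hh])
  have onef : ∀ h ∈ X, 1 ≤ din E f h := by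
    intro h hh
    rw [din, fibf h hh]
    obtain ⟨e0, he0, rfl⟩ := mem_image.1 hh
    exact card_pos.2 ⟨e0, by simp [he0]⟩
  have oneg : ∀ h ∈ Y, 1 ≤ din E g h := by
    intro h hh
    rw [din, fibg h hh]
    obtain ⟨e0, he0, rfl⟩ := mem_image.1 hh
    exact card_pos.2 ⟨e0, by simp [he0]⟩
  have lef : ∀ h ∈ X, din E f h ≤ Y.card := by
    intro h hh
    rw [din, fibf h hh]
    refine card_le_card_of_injOn g (fun e he => ?_) ?_
    · exact mem_image_of_mem g (mem_filter.1 he).1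
    · intro e he e' he' hee
      simp only [coe_filter, Set.mem_ofPred_eq] at he he'
      have := he.2.trans he'.2.symm
      simp only [hf, hg, Prod.mk.injEq] at this hee
      exact hinj e (hKE he.1) e' (hKE he'.1) this.1 hee.1
  have leg : ∀ h ∈ Y, din E g h ≤ X.card := by
    intro h hh
    rw [din, fibg h hh]
    refine card_le_card_of_injOn f (fun e he => ?_) ?_
    · exact mem_image_of_mem f (mem_filter.1 he).1
    · intro e he e' he' hee
      simp only [coe_filter, Set.mem_ofPred_eq] at he he'
      have := he.2.trans he'.2.symm
      simp only [hf, hg, Prod.mk.injEq] at this hee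
      exact hinj e (hKE he.1) e' (hKE he'.1) hee.1 this.1
  have hxy : K.card ≤ X.card * Y.card := by
    rw [← card_product]
    refine card_le_card_of_injOn (fun e => (f e, g e)) (fun e he => ?_) ?_
    · exact mem_product.2 ⟨mem_image_of_mem f he, mem_image_of_mem g he⟩
    · intro e he e' he' hee
      simp only [hf, hg, Prod.mk.injEq] at hee
      exact hinj e (hKE he) e' (hKE he') hee.1.1 hee.2.1
  -- the union bound
  have hT : K.card + ((∑ h ∈ X, din E f (h.1, !h.2)) + (∑ h ∈ Y, din E g (h.1, !h.2))) ≤ 7 := by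
    refine le_trans ?_ h7
    have e1 : ∑ h ∈ X, din E f (h.1, !h.2) = (X.biUnion fun h => E.filter (fun e => f e = (h.1, !h.2))).card := by
      rw [card_biUnion]
      · rfl
      · intro a _ b _ hab
        rw [Function.onFun, disjoint_left]
        intro e h1 h2
        simp only [mem_filter] at h1 h2
        apply hab
        have := h1.2.symm.trans h2.2
        simp only [Prod.mk.injEq, Bool.not_inj_iff] at this
        exact Prod.ext this.1 this.2
    have e2 : ∑ h ∈ Y, din E g (h.1, !h.2) = (Y.biUnion fun h => E.filter (fun e => g e = (h.1, !h.2))).card := by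
      rw [card_biUnion]
      · rfl
      · intro a _ b _ hab
        rw [Function.onFun, disjoint_left]
        intro e h1 h2
        simp only [mem_filter] at h1 h2
        apply hab
        have := h1.2.symm.trans h2.2
        simp only [Prod.mk.injEq, Bool.not_inj_iff] at this
        exact Prod.ext this.1 this.2
    have m1 : ∀ e ∈ (X.biUnion fun h => E.filter (fun e => f e = (h.1, !h.2))), e ∈ E ∧ κ (j e) = !c ∧ ρ (i e) = b ∧ ∃ e' ∈ K, i e = i e' := by
      intro e he
      simp only [mem_biUnion, mem_filter, hX, mem_image] at he
      obtain ⟨h, ⟨e0, he0, rfl⟩, heE, h1⟩ := he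
      simp only [hf, Prod.mk.injEq] at h1
      exact ⟨heE, by rw [h1.2, hc _ he0], by rw [h1.1, hb _ he0], e0, he0, h1.1⟩
    have m2 : ∀ e ∈ (Y.biUnion fun h => E.filter (fun e => g e = (h.1, !h.2))), e ∈ E ∧ κ (j e) = c ∧ ρ (i e) = !b ∧ ∃ e' ∈ K, j e = j e' := by
      intro e he
      simp only [mem_biUnion, mem_filter, hY, mem_image] at he
      obtain ⟨h, ⟨e0, he0, rfl⟩, heE, h1⟩ := he
      simp only [hg, Prod.mk.injEq] at h1
      exact ⟨heE, by rw [h1.1, hc _ he0], by rw [h1.2, hb _ he0], e0, he0, h1.1⟩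
    rw [e1, e2, ← card_union_of_disjoint, ← card_union_of_disjoint]
    · apply card_le_card
      intro e he
      rcases mem_union.1 he with he | he
      · exact mem_filter.2 ⟨hKE he, e, he, Or.inl rfl⟩
      rcases mem_union.1 he with he | he
      · obtain ⟨a1, -, -, e', a2, a3⟩ := m1 e he
        exact mem_filter.2 ⟨a1, e', a2, Or.inl a3⟩
      · obtain ⟨a1, -, -, e', a2, a3⟩ := m2 e he
        exact mem_filter.2 ⟨a1, e', a2, Or.inr a3⟩
    · rw [disjoint_left]
      intro e hK he
      rcases mem_union.1 he with he | he
      · have := (m1 e he).2.1; rw [hc e hK] at this; simp at this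
      · have := (m2 e he).2.2.1; rw [hb e hK] at this; simp at this
    · rw [disjoint_left]
      intro e h1 h2
      have := (m1 e h1).2.1; rw [(m2 e h2).2.1] at this; simp at this
  obtain ⟨sx, Lx, a0, a1, a2, a3, a4⟩ := side_sum X (din E f) (fun h => din E f (h.1, !h.2)) Y.card lef onef
  obtain ⟨sy, Ly, b0, b1, b2, b3, b4⟩ := side_sum Y (din E g) (fun h => din E g (h.1, !h.2)) X.card leg oneg
  have sumf' : ∑ h ∈ X, (din E f h : ℤ) = K.card := by exact_mod_cast sumf
  have sumg' : ∑ h ∈ Y, (din E g h : ℤ) = K.card := by exact_mod_cast sumg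
  have hT' : (K.card : ℤ) + ((∑ h ∈ X, (din E f (h.1, !h.2) : ℤ)) + (∑ h ∈ Y, (din E g (h.1, !h.2) : ℤ))) ≤ 7 := by
    exact_mod_cast hT
  have p1 : (0:ℤ) ≤ ∑ h ∈ X, (din E f (h.1, !h.2) : ℤ) := by positivity
  have p2 : (0:ℤ) ≤ ∑ h ∈ Y, (din E g (h.1, !h.2) : ℤ) := by positivity
  have q1 : 1 ≤ X.card := card_pos.2 (hne.image f)
  have q2 : 1 ≤ Y.card := card_pos.2 (hne.image g)
  have := num_local X.card Y.card K.card _ sx sy Lx Ly (by exact_mod_cast q1) (by exact_mod_cast q2)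
    (by exact_mod_cast card_image_le) (by exact_mod_cast card_image_le) (by exact_mod_cast hxy) hT' (by linarith)
    (by linarith) a1 b1 a0 b0 a2 b2
  unfold wF
  rw [a4, b4, sumf', sumg']
  linarith

theorem wF_sum_le {V : Type*} [DecidableEq V] (E : Finset V) (i : V → ZMod 7) (t : V → Bool) (S : Finset (ZMod 7 × Bool))
    (hn : ∀ c, (E.filter (fun e => i e = c)).card ≤ 7)
    (hS : ∀ h ∈ S, 1 ≤ din E (fun e => (i e, t e)) h) :
    ∑ h ∈ S, wF E (fun e => (i e, t e)) h ≤ 7 * 74 - 10 * E.card := by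
  set f : V → ZMod 7 × Bool := fun e => (i e, t e) with hf
  have hd : ∀ c, din E f (c, true) + din E f (c, false) = (E.filter (fun e => i e = c)).card := by
    intro c
    rw [din, din, ← card_union_of_disjoint]
    · congr 1
      ext e
      simp only [mem_union, mem_filter, hf, Prod.mk.injEq]
      cases t e <;> simp
    · rw [disjoint_left]
      intro e h1 h2
      have := (mem_filter.1 h1).2.symm.trans (mem_filter.1 h2).2
      simp at this
  have hsum : E.card = ∑ c : ZMod 7, (E.filter (fun e => i e = c)).card :=
    card_eq_sum_card_fiberwise (fun e _ => mem_univ _)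
  have key : ∑ h ∈ S, wF E f h ≤ ∑ h : ZMod 7 × Bool, (if 1 ≤ din E f h then wF E f h else 0) := by
    have hnn : ∀ h, 0 ≤ wF E f h := by
      rintro ⟨c, b⟩
      have h1 := hd c
      have h2 := hn c
      unfold wF
      apply mul_nonneg
      · split_ifs <;> norm_num
      · cases b <;> simp only [Bool.not_true, Bool.not_false] <;> omega
    rw [sum_congr rfl (fun h hh => (if_pos (hS h hh)).symm : ∀ h ∈ S, wF E f h = if 1 ≤ din E f h then wF E f h else 0)]
    apply sum_le_sum_of_subset_of_nonneg (subset_univ _)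
    intro h _ _
    split_ifs
    · exact hnn h
    · rfl
  refine key.trans ?_
  rw [Fintype.sum_prod_type]
  have : ∀ c : ZMod 7, ∑ b : Bool, (if 1 ≤ din E f (c, b) then wF E f (c, b) else 0) ≤ 74 - 10 * ((E.filter (fun e => i e = c)).card : ℤ) := by
    intro c
    have h1 := hd c
    have h2 := hn c
    rw [Fintype.sum_bool]
    simp only [wF, Bool.not_true, Bool.not_false]
    split_ifs <;> omega
  refine (sum_le_sum (fun c _ => this c)).trans ?_
  rw [sum_sub_distrib, ← mul_sum, hsum]
  simp

theorem combA {V ι : Type*} [DecidableEq V] [DecidableEq ι] [Fintype ι] (E : Finset V) (hE : E.card = 21) (i j : V → ZMod 7) (ρ κ : ZMod 7 → Bool)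
    (k : V → ι)
    (hinj : ∀ e ∈ E, ∀ e' ∈ E, i e = i e' → j e = j e' → e = e')
    (hk : ∀ e ∈ E, ∀ e' ∈ E, k e = k e' → ρ (i e) = ρ (i e') ∧ κ (j e) = κ (j e'))
    (hrow : ∀ e ∈ E, ∀ e' ∈ E, i e = i e' → κ (j e) = κ (j e') → k e = k e')
    (hcol : ∀ e ∈ E, ∀ e' ∈ E, j e = j e' → ρ (i e) = ρ (i e') → k e = k e')
    (hi7 : ∀ c, (E.filter (fun e => i e = c)).card ≤ 7)
    (hj7 : ∀ c, (E.filter (fun e => j e = c)).card ≤ 7)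
    (h7 : ∀ c, (E.filter (fun e => ∃ e' ∈ E.filter (fun e => k e = c), i e = i e' ∨ j e = j e')).card ≤ 7) :
    False := by
  set f : V → ZMod 7 × Bool := fun e => (i e, κ (j e)) with hf
  set g : V → ZMod 7 × Bool := fun e => (j e, ρ (i e)) with hg
  have hloc : ∀ c : ι, 30 * ((E.filter (fun e => k e = c)).card : ℤ) ≤
      ∑ h ∈ (E.filter (fun e => k e = c)).image f, wF E f h + ∑ h ∈ (E.filter (fun e => k e = c)).image g, wF E g h := by
    intro c
    rcases (E.filter (fun e => k e = c)).eq_empty_or_nonempty with h0 | hne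
    · rw [h0]; simp
    · obtain ⟨e0, he0⟩ := id hne
      rw [mem_filter] at he0
      refine local_ineq E _ i j ρ κ (filter_subset _ _) hne (ρ (i e0)) (κ (j e0)) ?_ ?_ hinj ?_ ?_ (h7 c)
      · intro e he
        rw [mem_filter] at he
        exact (hk e he.1 e0 he0.1 (he.2.trans he0.2.symm)).1
      · intro e he
        rw [mem_filter] at he
        exact (hk e he.1 e0 he0.1 (he.2.trans he0.2.symm)).2
      · intro e he e' he' h1 h2
        rw [mem_filter] at he ⊢
        refine ⟨he', (hrow e' he' e he.1 h1 ?_).trans he.2⟩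
        rw [h2]; exact (hk e0 he0.1 e he.1 (he0.2.trans he.2.symm)).2
      · intro e he e' he' h1 h2
        rw [mem_filter] at he ⊢
        refine ⟨he', (hcol e' he' e he.1 h1 ?_).trans he.2⟩
        rw [h2]; exact (hk e0 he0.1 e he.1 (he0.2.trans he.2.symm)).1
  have htot := sum_le_sum (fun c (_ : c ∈ (univ : Finset ι)) => hloc c)
  rw [sum_add_distrib, ← mul_sum] at htot
  have hc : (∑ c : ι, ((E.filter (fun e => k e = c)).card : ℤ)) = 21 := by
    rw [← Nat.cast_sum, ← card_eq_sum_card_fiberwise (fun e _ => mem_coe.2 (mem_univ _)), hE]; rfl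
  have dj : ∀ (q : V → ZMod 7 × Bool), (∀ e ∈ E, ∀ e' ∈ E, q e = q e' → k e = k e') →
      Set.PairwiseDisjoint (↑(univ : Finset ι)) (fun c => (E.filter (fun e => k e = c)).image q) := by
    intro q hq c _ c' _ hcc
    rw [Function.onFun, disjoint_left]
    intro h h1 h2
    simp only [mem_image, mem_filter] at h1 h2
    obtain ⟨e, ⟨he, hec⟩, h1⟩ := h1
    obtain ⟨e', ⟨he', hec'⟩, h2⟩ := h2
    exact hcc (by rw [← hec, ← hec']; exact hq e he e' he' (h1.trans h2.symm))
  have df := dj f (fun e he e' he' h => by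
    simp only [hf, Prod.mk.injEq] at h
    exact hrow e he e' he' h.1 h.2)
  have dg := dj g (fun e he e' he' h => by
    simp only [hg, Prod.mk.injEq] at h
    exact hcol e he e' he' h.1 h.2)
  rw [← sum_biUnion df, ← sum_biUnion dg, hc] at htot
  have h1 := wF_sum_le E i (fun e => κ (j e)) (univ.biUnion fun c => (E.filter (fun e => k e = c)).image f) hi7 (by
    intro h hh
    simp only [mem_biUnion, mem_image, mem_filter] at hh
    obtain ⟨c, -, e, he, rfl⟩ := hh
    exact card_pos.2 ⟨e, by simp [hf, he.1]⟩)
  have h2 := wF_sum_le E j (fun e => ρ (i e)) (univ.biUnion fun c => (E.filter (fun e => k e = c)).image g) hj7 (by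
    intro h hh
    simp only [mem_biUnion, mem_image, mem_filter] at hh
    obtain ⟨c, -, e, he, rfl⟩ := hh
    exact card_pos.2 ⟨e, by simp [hg, he.1]⟩)
  rw [hE] at h1 h2
  push_cast at h1 h2
  linarith

theorem heavy_sum {ι : Type*} [DecidableEq ι] (C : Finset ι) (m : ι → ℕ) (h2 : 2 ≤ C.card)
    (hp : ∀ a ∈ C, ∀ b ∈ C, a ≠ b → m a + m b ≤ 7) : ∑ a ∈ C, m a ≤ 3 * C.card + 1 := by
  by_cases h : ∀ a ∈ C, m a ≤ 3
  · have : ∑ a ∈ C, m a ≤ C.card • 3 := sum_le_card_nsmul C m 3 h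
    simp only [smul_eq_mul] at this
    omega
  · push Not at h
    obtain ⟨a, ha, h4⟩ := h
    have hc : (C.erase a).card = C.card - 1 := card_erase_of_mem ha
    obtain ⟨b, hb⟩ : (C.erase a).Nonempty := card_pos.1 (by omega)
    have hc' : ((C.erase a).erase b).card = C.card - 2 := by rw [card_erase_of_mem hb]; omega
    rw [← add_sum_erase C m ha, ← add_sum_erase _ m hb]
    have hab := hp a ha b (mem_of_mem_erase hb) (ne_of_mem_erase hb).symm
    have : ∑ x ∈ (C.erase a).erase b, m x ≤ ((C.erase a).erase b).card • 3 := sum_le_card_nsmul ((C.erase a).erase b) m 3 (by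
      intro c hc
      have h1 := mem_of_mem_erase hc
      have := hp a ha c (mem_of_mem_erase h1) (ne_of_mem_erase h1).symm
      omega)
    simp only [smul_eq_mul] at this
    omega

theorem light_sum {V : Type*} [DecidableEq V] (L : Finset V) (i j g : V → ZMod 7) (q : ℕ)
    (hinj : ∀ e ∈ L, ∀ e' ∈ L, i e = i e' → j e = j e' → e = e')
    (hi : ∀ e ∈ L, ∀ e' ∈ L, i e = i e' → g e = g e')
    (hj : ∀ e ∈ L, ∀ e' ∈ L, j e = j e' → g e = g e')
    (hg : ∀ c, (L.filter (fun e => g e = c)).card ≤ 7)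
    (hqi : (L.image i).card ≤ q) (hqj : (L.image j).card ≤ q) : 5 * L.card ≤ 12 * q := by
  have hdis : ∀ f : V → ZMod 7, (∀ e ∈ L, ∀ e' ∈ L, f e = f e' → g e = g e') →
      ∑ c : ZMod 7, ((L.filter (fun e => g e = c)).image f).card ≤ (L.image f).card := by
    intro f hf
    rw [← card_biUnion]
    · apply card_le_card
      intro x hx
      simp only [mem_biUnion, mem_image, mem_filter] at hx ⊢
      obtain ⟨c, -, e, he, rfl⟩ := hx
      exact ⟨e, he.1, rfl⟩
    · intro c _ c' _ hcc
      rw [Function.onFun, disjoint_left]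
      intro h h1 h2
      simp only [mem_image, mem_filter] at h1 h2
      obtain ⟨e, ⟨he, hec⟩, h1⟩ := h1
      obtain ⟨e', ⟨he', hec'⟩, h2⟩ := h2
      exact hcc (by rw [← hec, ← hec']; exact hf e he e' he' (h1.trans h2.symm))
  have hloc : ∀ c : ZMod 7, 5 * (L.filter (fun e => g e = c)).card ≤
      6 * ((L.filter (fun e => g e = c)).image i).card + 6 * ((L.filter (fun e => g e = c)).image j).card := by
    intro c
    have h7 := hg c
    set K := L.filter (fun e => g e = c)
    have hKL : K ⊆ L := filter_subset _ _
    have hxy : K.card ≤ (K.image i).card * (K.image j).card := by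
      rw [← card_product]
      refine card_le_card_of_injOn (fun e => (i e, j e)) (fun e he => ?_) ?_
      · exact mem_product.2 ⟨mem_image_of_mem i he, mem_image_of_mem j he⟩
      · intro e he e' he' hee
        simp only [Prod.mk.injEq] at hee
        exact hinj e (hKL he) e' (hKL he') hee.1 hee.2
    have hx : (K.image i).card ≤ K.card := card_image_le
    have hy : (K.image j).card ≤ K.card := card_image_le
    generalize (K.image i).card = x at *
    generalize (K.image j).card = y at *
    generalize K.card = n at *
    have hx7 : x ≤ 7 := by omega
    clear_value K
    interval_cases x <;> omega
  have hs := sum_le_sum (fun c (_ : c ∈ (univ : Finset (ZMod 7))) => hloc c)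
  rw [sum_add_distrib, ← mul_sum, ← mul_sum, ← mul_sum, ← card_eq_sum_card_fiberwise (fun e _ => mem_coe.2 (mem_univ _))] at hs
  have := hdis i hi
  have := hdis j hj
  omega

theorem combB {V : Type*} [DecidableEq V] (E : Finset V) (hE : E.card = 21) (i j g : V → ZMod 7)
    (hheavy : ∃ e ∈ E, ∃ e' ∈ E, e ≠ e' ∧ i e = i e' ∧ j e = j e')
    (hg7 : ∀ c, (E.filter (fun e => g e = c)).card ≤ 7)
    (hpl : ∀ a b c : ZMod 7, (a ≠ 0 ∨ b ≠ 0) → (E.filter (fun e => a * i e + b * j e = c)).card ≤ 7)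
    (hsep : ∀ e ∈ E, ∀ e' ∈ E, i e = i e' → j e = j e' → g e = g e' → e = e')
    (hrow : ∀ e ∈ E, ∀ e' ∈ E, i e = i e' → j e ≠ j e' → g e = g e')
    (hcol : ∀ e ∈ E, ∀ e' ∈ E, j e = j e' → i e ≠ i e' → g e = g e') :
    (E.image (fun e => (i e, j e))).card ≤ 7 := by
  set H := E.filter (fun e => ∃ e' ∈ E, e ≠ e' ∧ i e = i e' ∧ j e = j e') with hH
  set L := E.filter (fun e => ¬ ∃ e' ∈ E, e ≠ e' ∧ i e = i e' ∧ j e = j e') with hL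
  set cell : V → ZMod 7 × ZMod 7 := fun e => (i e, j e) with hcell
  have hHL : H.card + L.card = 21 := by rw [← hE]; exact card_filter_add_card_filter_not _
  have hHrow : ∀ e ∈ H, ∀ e' ∈ E, i e = i e' → j e = j e' := by
    intro e he e'' he'' h1
    rw [hH, mem_filter] at he
    obtain ⟨heE, e', he', hne, h2, h3⟩ := he
    by_contra h4
    apply hne
    refine hsep e heE e' he' h2 h3 ?_
    rw [hrow e heE e'' he'' h1 h4, hrow e' he' e'' he'' (h2 ▸ h1) (h3 ▸ h4)]
  have hHcol : ∀ e ∈ H, ∀ e' ∈ E, j e = j e' → i e = i e' := by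
    intro e he e'' he'' h1
    rw [hH, mem_filter] at he
    obtain ⟨heE, e', he', hne, h2, h3⟩ := he
    by_contra h4
    apply hne
    refine hsep e heE e' he' h2 h3 ?_
    rw [hcol e heE e'' he'' h1 h4, hcol e' he' e'' he'' (h3 ▸ h1) (h2 ▸ h4)]
  have hHE : H ⊆ E := filter_subset _ _
  have hLE : L ⊆ E := filter_subset _ _
  have hLinj : ∀ e ∈ L, ∀ e' ∈ E, i e = i e' → j e = j e' → e = e' := by
    intro e he e' he' h1 h2
    by_contra h3
    exact (mem_filter.1 he).2 ⟨e', he', h3, h1, h2⟩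
  set k := (H.image cell).card with hk
  -- rows of H
  have hki : (H.image i).card = k := by
    have : H.image i = (H.image cell).image Prod.fst := by rw [image_image]; rfl
    rw [this, card_image_of_injOn]
    intro a ha b hb hab
    simp only [coe_image, Set.mem_image, mem_coe] at ha hb
    obtain ⟨e, he, rfl⟩ := ha
    obtain ⟨e', he', rfl⟩ := hb
    exact Prod.ext hab (hHrow e he e' (hHE he') hab)
  have hkj : (H.image j).card = k := by
    have : H.image j = (H.image cell).image Prod.snd := by rw [image_image]; rfl
    rw [this, card_image_of_injOn]
    intro a ha b hb hab
    simp only [coe_image, Set.mem_image, mem_coe] at ha hb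
    obtain ⟨e, he, rfl⟩ := ha
    obtain ⟨e', he', rfl⟩ := hb
    exact Prod.ext (hHcol e he e' (hHE he') hab) hab
  have hLi : k + (L.image i).card ≤ 7 := by
    rw [← hki, ← card_union_of_disjoint]
    · exact (card_le_univ _).trans (by simp)
    · rw [disjoint_left]
      intro x hx hy
      obtain ⟨e, he, rfl⟩ := mem_image.1 hx
      obtain ⟨e', he', h1⟩ := mem_image.1 hy
      have h2 := hHrow e he e' (hLE he') h1.symm
      have := hLinj e' he' e (hHE he) h1 h2.symm
      rw [← this] at he
      exact (mem_filter.1 he').2 (mem_filter.1 he).2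
  have hLj : k + (L.image j).card ≤ 7 := by
    rw [← hkj, ← card_union_of_disjoint]
    · exact (card_le_univ _).trans (by simp)
    · rw [disjoint_left]
      intro x hx hy
      obtain ⟨e, he, rfl⟩ := mem_image.1 hx
      obtain ⟨e', he', h1⟩ := mem_image.1 hy
      have h2 := hHcol e he e' (hLE he') h1.symm
      have := hLinj e' he' e (hHE he) h2.symm h1
      rw [← this] at he
      exact (mem_filter.1 he').2 (mem_filter.1 he).2
  by_cases hN : k + L.card ≤ 7
  · have : E.image cell = H.image cell ∪ L.image cell := by
      rw [← image_union, hH, hL, filter_union_filter_not_eq]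
    rw [this]
    have h1 := card_union_le (H.image cell) (L.image cell)
    have h2 : (L.image cell).card ≤ L.card := card_image_le
    omega
  exfalso
  have hk1 : 1 ≤ k := by
    obtain ⟨e, he, e', he', h⟩ := hheavy
    exact card_pos.2 ⟨cell e, mem_image_of_mem _ (mem_filter.2 ⟨he, e', he', h⟩)⟩
  have hL12 : 5 * L.card ≤ 12 * (7 - k) := by
    refine light_sum L i j g (7 - k) (fun e he e' he' => hLinj e he e' (hLE he')) ?_ ?_ ?_ (by omega) (by omega)
    · intro e he e' he' h
      by_cases h2 : j e = j e'
      · rw [hLinj e he e' (hLE he') h h2]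
      · exact hrow e (hLE he) e' (hLE he') h h2
    · intro e he e' he' h
      by_cases h2 : i e = i e'
      · rw [hLinj e he e' (hLE he') h2 h]
      · exact hcol e (hLE he) e' (hLE he') h h2
    · intro c
      exact (card_le_card (filter_subset_filter _ hLE)).trans (hg7 c)
  have hLsq : L.card ≤ (L.image i).card * (L.image j).card := by
    rw [← card_product]
    refine card_le_card_of_injOn cell (fun e he => ?_) ?_
    · exact mem_product.2 ⟨mem_image_of_mem i he, mem_image_of_mem j he⟩
    · intro e he e' he' hee
      simp only [hcell, Prod.mk.injEq] at hee
      exact hLinj e he e' (hLE he') hee.1 hee.2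
  -- two cells in a plane
  have hpair : ∀ a b : ZMod 7 × ZMod 7, a ≠ b →
      (E.filter (fun e => cell e = a)).card + (E.filter (fun e => cell e = b)).card ≤ 7 := by
    intro a b hab
    rw [← card_union_of_disjoint]
    · refine le_trans (card_le_card ?_) (hpl (b.2 - a.2) (a.1 - b.1) ((b.2 - a.2) * a.1 + (a.1 - b.1) * a.2) ?_)
      · intro e he
        simp only [mem_union, mem_filter, hcell] at he ⊢
        rcases he with ⟨h1, h2⟩ | ⟨h1, h2⟩
        · exact ⟨h1, by rw [← h2]⟩
        · refine ⟨h1, ?_⟩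
          rw [← h2]; ring
      · by_contra hcon
        push Not at hcon
        exact hab (Prod.ext (sub_eq_zero.1 hcon.2) (sub_eq_zero.1 hcon.1).symm)
    · rw [disjoint_left]
      intro e h1 h2
      exact hab ((mem_filter.1 h1).2.symm.trans (mem_filter.1 h2).2)
  have hHsum : H.card = ∑ c ∈ H.image cell, (E.filter (fun e => cell e = c)).card := by
    rw [card_eq_sum_card_image cell H]
    refine sum_congr rfl fun c hc => ?_
    obtain ⟨e0, he0, rfl⟩ := mem_image.1 hc
    congr 1
    ext e
    simp only [mem_filter]
    constructor
    · rintro ⟨h1, h2⟩; exact ⟨hHE h1, h2⟩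
    · rintro ⟨h1, h2⟩
      refine ⟨?_, h2⟩
      simp only [hcell, Prod.mk.injEq] at h2
      by_contra hnot
      have heL : e ∈ L := mem_filter.2 ⟨h1, fun hh => hnot (mem_filter.2 ⟨h1, hh⟩)⟩
      have := hLinj e heL e0 (hHE he0) h2.1 h2.2
      rw [this] at hnot
      exact hnot he0
  rcases Nat.lt_or_ge k 2 with hk2 | hk2
  · have hk' : k = 1 := by omega
    obtain ⟨c, hc⟩ := card_eq_one.1 (hk.symm.trans hk')
    rw [hc, sum_singleton] at hHsum
    obtain ⟨e, he⟩ : L.Nonempty := card_pos.1 (by omega)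
    have h1 : 1 ≤ (E.filter (fun e' => cell e' = cell e)).card := card_pos.2 ⟨e, by simp [hLE he]⟩
    have hne : c ≠ cell e := by
      intro h
      obtain ⟨e0, he0, h0⟩ := mem_image.1 (show c ∈ H.image cell by rw [hc]; simp)
      rw [h] at h0
      simp only [hcell, Prod.mk.injEq] at h0
      have := hLinj e he e0 (hHE he0) h0.1.symm h0.2.symm
      rw [← this] at he0
      exact (mem_filter.1 he).2 (mem_filter.1 he0).2
    have := hpair c (cell e) hne
    omega
  · have := heavy_sum (H.image cell) (fun c => (E.filter (fun e => cell e = c)).card) hk2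
      (fun a _ b _ hab => hpair a b hab)
    rw [← hHsum, ← hk] at this
    have hk7 : k ≤ 7 := by omega
    have h1 : (L.image i).card ≤ 7 - k := by omega
    have h2 : (L.image j).card ≤ 7 - k := by omega
    have h3 := hLsq.trans (Nat.mul_le_mul h1 h2)
    clear_value k
    interval_cases k <;> omega
theorem chr_eq (a x : Fin 3 → ZMod 7) : chr 7 a x = ZMod.stdAddChar (∑ i, x i * a i) := by
  rw [chr, ZMod.stdAddChar_apply, ZMod.toCircle_apply]

theorem equidist {ι : Type*} [DecidableEq ι] (A : Finset ι) (hA : A.card = 21) (f : ι → ZMod 7)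
    (h : ∑ a ∈ A, ZMod.stdAddChar (f a) = (0 : ℂ)) (t : ZMod 7) :
    (A.filter (fun a => f a = t)).card = 3 := by
  set n : ZMod 7 → ℕ := fun t => (A.filter (fun a => f a = t)).card with hn
  have hsum : ∑ t, n t = 21 := by
    rw [← hA]; exact (card_eq_sum_card_fiberwise (fun e _ => mem_coe.2 (mem_univ _))).symm
  set ζ : ℂ := ZMod.stdAddChar (1 : ZMod 7) with hζ
  have hz : ζ = Complex.exp (2 * Real.pi * Complex.I / (7 : ℕ)) := by
    rw [hζ, ZMod.stdAddChar_apply, ZMod.toCircle_apply]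
    have : ((1 : ZMod 7).val) = 1 := rfl
    rw [this]; norm_num
  have hprim : IsPrimitiveRoot ζ 7 := by
    rw [hz]; exact Complex.isPrimitiveRoot_exp 7 (by norm_num)
  have hpow : ∀ k : ℕ, (ZMod.stdAddChar (k : ZMod 7) : ℂ) = ζ ^ k := by
    intro k
    rw [hζ, ← AddChar.map_nsmul_eq_pow]; simp
  have hs : ∑ t : ZMod 7, (n t : ℂ) * ZMod.stdAddChar t = 0 := by
    rw [← h, ← sum_fiberwise (s := A) (g := f)]
    refine sum_congr rfl fun t _ => ?_
    rw [sum_congr rfl (fun a ha => by rw [(mem_filter.1 ha).2] :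
      ∀ a ∈ A.filter (fun a => f a = t), (ZMod.stdAddChar (f a) : ℂ) = ZMod.stdAddChar t)]
    simp [hn]
  have hgeom : ∑ k ∈ range 7, ζ ^ k = 0 := hprim.geom_sum_eq_zero (by norm_num)
  have hdeg : (minpoly ℚ ζ).natDegree = 6 := by
    rw [← Polynomial.cyclotomic_eq_minpoly_rat hprim (by norm_num), Polynomial.natDegree_cyclotomic]
    rfl
  have hli : LinearIndependent ℚ (fun i : Fin 6 => ζ ^ (i : ℕ)) := by
    have := linearIndependent_pow (K := ℚ) ζ
    rw [hdeg] at this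
    exact this
  have hall : ∀ k : Fin 6, n ((k : ℕ) : ZMod 7) = n 6 := by
    rw [Fintype.linearIndependent_iff] at hli
    have := hli (fun k => (n ((k : ℕ) : ZMod 7) : ℚ) - n 6) (by
      have e1 : ∑ k ∈ range 7, (n (k : ZMod 7) : ℂ) * ζ ^ k = 0 := by
        rw [← hs]
        rw [← Fin.sum_univ_eq_sum_range (fun k => (n (k : ZMod 7) : ℂ) * ζ ^ k) 7]
        refine sum_congr rfl fun k _ => ?_
        rw [← hpow]
        have hk : (((k : Fin 7) : ℕ) : ZMod 7) = k := by
          exact ZMod.natCast_zmod_val (n := 7) k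
        rw [hk]
      have e2 : ∑ k ∈ range 7, ((n (k : ZMod 7) : ℂ) - n 6) * ζ ^ k = 0 := by
        simp_rw [sub_mul]
        rw [sum_sub_distrib, e1, ← mul_sum, hgeom]; simp
      rw [sum_range_succ] at e2
      have e3 : ((6 : ℕ) : ZMod 7) = 6 := rfl
      rw [e3, sub_self, zero_mul, add_zero] at e2
      rw [← e2, ← Fin.sum_univ_eq_sum_range (fun k => ((n (k : ZMod 7) : ℂ) - n 6) * ζ ^ k) 6]
      refine sum_congr rfl fun k _ => ?_
      rw [Algebra.smul_def]; simp)
    intro k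
    have h1 := this k
    rw [sub_eq_zero] at h1
    exact_mod_cast h1
  have h0 := hall 0
  have h1 := hall 1
  have h2 := hall 2
  have h3 := hall 3
  have h4 := hall 4
  have h5 := hall 5
  have hs7 : n 0 + n 1 + n 2 + n 3 + n 4 + n 5 + n 6 = 21 := by
    rw [← hsum]; exact (Fin.sum_univ_seven (fun k : Fin 7 => n (k : ZMod 7))).symm
  change n 0 = _ at h0
  change n 1 = _ at h1
  change n 2 = _ at h2
  change n 3 = _ at h3
  change n 4 = _ at h4
  change n 5 = _ at h5
  change n t = 3
  have : t = 0 ∨ t = 1 ∨ t = 2 ∨ t = 3 ∨ t = 4 ∨ t = 5 ∨ t = 6 := by revert t; decide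
  rcases this with rfl | rfl | rfl | rfl | rfl | rfl | rfl <;> omega

theorem spec_equi (E A : Finset (Fin 3 → ZMod 7)) (hE : E.card = 21) (h : IsSpectralPair 7 E A) :
    A.card = 21 ∧ ∀ e ∈ E, ∀ e' ∈ E, e ≠ e' → ∀ t,
      (A.filter (fun a => ∑ i, (e - e') i * a i = t)).card = 3 := by
  obtain ⟨horth, hspan, hind⟩ := h
  let Φ : (A → ℂ) →ₗ[ℂ] (E → ℂ) :=
    { toFun := fun c x => ∑ a : A, c a * chr 7 a.1 x.1
      map_add' := by intro c c'; ext x; simp [add_mul, sum_add_distrib]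
      map_smul' := by intro m c; ext x; simp [mul_sum, mul_assoc] }
  have hbij : Function.Bijective Φ := by
    constructor
    · rw [injective_iff_map_eq_zero]
      intro c hc
      funext a
      exact hind c (fun x => congrFun hc x) a
    · intro f
      obtain ⟨c, hc⟩ := hspan f
      exact ⟨c, funext fun x => (hc x).symm⟩
  have hcard : Fintype.card A = Fintype.card E := by
    have := (LinearEquiv.ofBijective Φ hbij).finrank_eq
    simpa using this
  have hA : A.card = 21 := by simpa [hE] using hcard
  refine ⟨hA, ?_⟩
  let M : Matrix A E ℂ := fun a e => chr 7 a.1 e.1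
  let N : Matrix E A ℂ := fun e a => (1 / 21 : ℂ) * (starRingEnd ℂ) (chr 7 a.1 e.1)
  have hnorm : ∀ a x : Fin 3 → ZMod 7, chr 7 a x * (starRingEnd ℂ) (chr 7 a x) = 1 := by
    intro a x
    rw [chr_eq, ← AddChar.map_neg_eq_conj, ← AddChar.map_add_eq_mul]; simp
  have hMN : M * N = 1 := by
    ext a b
    rw [Matrix.mul_apply, Matrix.one_apply]
    have : ∑ e : E, M a e * N e b = (1 / 21 : ℂ) * ∑ x ∈ E, chr 7 a.1 x * (starRingEnd ℂ) (chr 7 b.1 x) := by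
      rw [← sum_coe_sort E, mul_sum]
      refine sum_congr rfl fun e _ => ?_
      simp only [M, N]; ring
    rw [this]
    split_ifs with hab
    · subst hab
      simp_rw [hnorm]
      simp [hE]
    · rw [horth a.1 a.2 b.1 b.2 (fun hh => hab (Subtype.ext hh)), mul_zero]
  have hNM : N * M = 1 := (Matrix.mul_eq_one_comm_of_card_eq _ _ _ hcard).1 hMN
  intro e he e' he' hne t
  refine equidist A hA (fun a => ∑ i, (e - e') i * a i) ?_ t
  have h1 : (N * M) ⟨e', he'⟩ ⟨e, he⟩ = 0 := by
    rw [hNM, Matrix.one_apply_ne]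
    intro hh
    exact hne (Subtype.ext_iff.1 hh).symm
  rw [Matrix.mul_apply] at h1
  have h2 : ∑ a : A, N ⟨e', he'⟩ a * M a ⟨e, he⟩ =
      (1 / 21 : ℂ) * ∑ a ∈ A, (ZMod.stdAddChar (∑ i, (e - e') i * a i) : ℂ) := by
    rw [← sum_coe_sort A, mul_sum]
    refine sum_congr rfl fun a _ => ?_
    simp only [M, N, chr_eq]
    rw [← AddChar.map_neg_eq_conj, mul_assoc, ← AddChar.map_add_eq_mul]
    congr 2
    rw [neg_add_eq_sub, ← sum_sub_distrib]
    refine sum_congr rfl fun i _ => ?_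
    rw [Pi.sub_apply]; ring
  rw [h2] at h1
  simpa using h1

theorem fact_seven : Fact (Nat.Prime 7) := ⟨by norm_num⟩

section field
attribute [local instance] fact_seven

theorem card_ker_two (f : (Fin 3 → ZMod 7) →ₗ[ZMod 7] ZMod 7) (hf : f ≠ 0) :
    (univ.filter (fun v => f v = 0)).card = 49 := by
  have h1 := LinearMap.finrank_range_add_finrank_ker f
  have h2 : LinearMap.range f = ⊤ := LinearMap.range_eq_top.2 (LinearMap.surjective hf)
  rw [h2] at h1
  simp only [finrank_top, Module.finrank_self, Module.finrank_fin_fun] at h1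
  have h3 : Module.finrank (ZMod 7) (LinearMap.ker f) = 2 := by omega
  have h4 := Module.natCard_eq_pow_finrank (K := ZMod 7) (V := LinearMap.ker f)
  rw [h3, Nat.card_zmod] at h4
  rw [← Fintype.card_subtype, ← Nat.card_eq_fintype_card]
  exact h4

theorem card_ker_dvd (f g : (Fin 3 → ZMod 7) →ₗ[ZMod 7] ZMod 7) :
    7 ∣ (univ.filter (fun v => f v = 0 ∧ g v = 0)).card := by
  have h1 := LinearMap.finrank_range_add_finrank_ker (f.prod g)
  have h2 := Submodule.finrank_le (LinearMap.range (f.prod g))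
  simp only [Module.finrank_prod, Module.finrank_self, Module.finrank_fin_fun] at h1 h2
  have h4 := Module.natCard_eq_pow_finrank (K := ZMod 7) (V := LinearMap.ker (f.prod g))
  rw [Nat.card_zmod] at h4
  have h5 : (univ.filter (fun v => f v = 0 ∧ g v = 0)).card =
      Nat.card (LinearMap.ker (f.prod g)) := by
    rw [← Fintype.card_subtype, ← Nat.card_eq_fintype_card]
    refine Nat.card_congr (Equiv.subtypeEquivRight ?_)
    intro v
    rw [LinearMap.mem_ker]
    change _ ↔ (f v, g v) = 0
    rw [Prod.mk_eq_zero]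
  rw [h5, h4]
  exact dvd_pow_self 7 (by omega)

theorem plane_le (E : Finset (Fin 3 → ZMod 7)) (hE : E.card = 21) (hsp : IsSpectral 7 E)
    (f : (Fin 3 → ZMod 7) →ₗ[ZMod 7] ZMod 7) (hf : f ≠ 0) (c : ZMod 7) :
    (E.filter (fun e => f e = c)).card ≤ 7 := by
  obtain ⟨A, hA⟩ := hsp
  obtain ⟨hA21, heq⟩ := spec_equi E A hE hA
  by_contra hcon
  push Not at hcon
  set S := E.filter (fun e => f e = c) with hS
  obtain ⟨e0, he0⟩ : S.Nonempty := card_pos.1 (by omega)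
  have hdet : ∀ v, f v = 0 → v ≠ 0 → ∃ e ∈ E, ∃ e' ∈ E, e ≠ e' ∧ ∃ m : ZMod 7, m ≠ 0 ∧ e - e' = m • v := by
    intro v hv hv0
    have hlt : (univ.filter (fun v => f v = 0)).card < (S ×ˢ (univ : Finset (ZMod 7))).card := by
      rw [card_ker_two f hf, card_product, card_univ, ZMod.card]; omega
    obtain ⟨⟨e, m⟩, h1, ⟨e', m'⟩, h2, hne, heq'⟩ := exists_ne_map_eq_of_card_lt_of_maps_to hlt
      (f := fun x => x.1 - e0 + x.2 • v) (by
        intro x hx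
        have hx1 := (mem_product.1 hx).1
        rw [hS, mem_filter] at hx1 he0
        simp [hx1.2, he0.2, hv])
    simp only [mem_product, hS, mem_filter] at h1 h2
    have hdiff : e - e' = (m' - m) • v := by
      simp only at heq'
      rw [sub_smul, sub_eq_sub_iff_add_eq_add, add_comm _ e']
      have := congrArg (fun z => z + e0) heq'
      simp only [sub_add_eq_add_sub, add_sub_cancel_right] at this
      exact this
    have hm : m' - m ≠ 0 := by
      intro h0
      rw [h0, zero_smul] at hdiff
      exact hne (Prod.ext (sub_eq_zero.1 hdiff) (sub_eq_zero.1 h0).symm)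
    refine ⟨e, h1.1.1, e', h2.1.1, ?_, m' - m, hm, hdiff⟩
    intro hee
    rw [hee, sub_self] at hdiff
    exact (smul_ne_zero hm hv0) hdiff.symm
  obtain ⟨a0, ha0⟩ : A.Nonempty := card_pos.1 (by omega)
  have hcnt : ∀ v, f v = 0 → v ≠ 0 → (A.filter (fun a => ∑ i, v i * (a - a0) i = 0)).card = 3 := by
    intro v hv hv0
    obtain ⟨e, he, e', he', hne, m, hm, hd⟩ := hdet v hv hv0
    refine Eq.trans ?_ (heq e he e' he' hne (∑ i, (e - e') i * a0 i))
    congr 1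
    ext a
    simp only [mem_filter, and_congr_right_iff]
    intro _
    rw [hd, ← sub_eq_zero (b := ∑ i, (m • v) i * a0 i), ← sum_sub_distrib]
    have : ∑ i, ((m • v) i * a i - (m • v) i * a0 i) = m * ∑ i, v i * (a - a0) i := by
      rw [mul_sum]
      refine sum_congr rfl fun i _ => ?_
      simp only [Pi.smul_apply, Pi.sub_apply, smul_eq_mul]; ring
    rw [this]
    simp [hm]
  have hdc := sum_card_bipartiteAbove_eq_sum_card_bipartiteBelow
    (s := univ.filter (fun v => f v = 0)) (t := A) (fun v a => ∑ i, v i * (a - a0) i = 0)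
  have hleft : ∑ v ∈ univ.filter (fun v => f v = 0), (A.filter (fun a => ∑ i, v i * (a - a0) i = 0)).card = 165 := by
    have h0 : (0 : Fin 3 → ZMod 7) ∈ univ.filter (fun v => f v = 0) := by simp
    rw [← add_sum_erase _ _ h0]
    rw [sum_congr rfl (g := fun _ => 3) (fun v hv => by
      have h1 := mem_erase.1 hv
      exact hcnt v (mem_filter.1 h1.2).2 h1.1)]
    rw [sum_const, card_erase_of_mem h0, card_ker_two f hf]
    simp [hA21]
  have hright : 7 ∣ ∑ a ∈ A, ((univ.filter (fun v => f v = 0)).filter (fun v => ∑ i, v i * (a - a0) i = 0)).card := by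
    apply dvd_sum
    intro a _
    rw [filter_filter]
    let g : (Fin 3 → ZMod 7) →ₗ[ZMod 7] ZMod 7 :=
      { toFun := fun v => ∑ i, v i * (a - a0) i
        map_add' := by intro x y; simp only [Pi.add_apply, add_mul, sum_add_distrib]
        map_smul' := by intro m x; simp only [Pi.smul_apply, smul_eq_mul, RingHom.id_apply, mul_sum, mul_assoc] }
    exact card_ker_dvd f g
  simp only [bipartiteAbove, bipartiteBelow] at hdc
  rw [← hdc, hleft] at hright
  norm_num at hright

theorem functional_of_plane (P : Submodule (ZMod 7) (Fin 3 → ZMod 7))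
    (hP : Module.finrank (ZMod 7) P = 2) :
    ∃ f : (Fin 3 → ZMod 7) →ₗ[ZMod 7] ZMod 7, LinearMap.ker f = P := by
  have hlt : P < ⊤ := by
    rw [lt_top_iff_ne_top]
    rintro rfl
    simp at hP
  obtain ⟨f, hf, hle⟩ := Submodule.exists_le_ker_of_lt_top P hlt
  refine ⟨f, (Submodule.eq_of_le_of_finrank_eq hle ?_).symm⟩
  have h1 := LinearMap.finrank_range_add_finrank_ker f
  have h2 : LinearMap.range f = ⊤ := LinearMap.range_eq_top.2 (LinearMap.surjective hf)
  rw [h2] at h1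
  simp only [finrank_top, Module.finrank_self, Module.finrank_fin_fun] at h1
  omega

theorem exists_normalized (P Q : Submodule (ZMod 7) (Fin 3 → ZMod 7)) (hne : P ≠ Q)
    (hP : Module.finrank (ZMod 7) P = 2) (hQ : Module.finrank (ZMod 7) Q = 2)
    (f : (Fin 3 → ZMod 7) →ₗ[ZMod 7] ZMod 7) (hf : LinearMap.ker f = Q) :
    ∃ p ∈ P, f p = 1 := by
  have hnle : ¬ P ≤ Q := fun h => hne (Submodule.eq_of_le_of_finrank_eq h (by omega))
  obtain ⟨p, hp, hq⟩ := SetLike.not_le_iff_exists.1 hnle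
  rw [← hf, LinearMap.mem_ker] at hq
  exact ⟨(f p)⁻¹ • p, P.smul_mem _ hp, by simp [hq]⟩

theorem coords (P₁ P₂ : Submodule (ZMod 7) (Fin 3 → ZMod 7)) (hne : P₁ ≠ P₂)
    (hP₁ : Module.finrank (ZMod 7) P₁ = 2) (hP₂ : Module.finrank (ZMod 7) P₂ = 2) :
    ∃ (α β γ : (Fin 3 → ZMod 7) →ₗ[ZMod 7] ZMod 7) (q p w : Fin 3 → ZMod 7),
      LinearMap.ker α = P₁ ∧ LinearMap.ker β = P₂ ∧ α q = 1 ∧ α p = 0 ∧ α w = 0 ∧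
      β q = 0 ∧ β p = 1 ∧ β w = 0 ∧ γ q = 0 ∧ γ p = 0 ∧ γ w = 1 ∧
      ∀ x, x = α x • q + β x • p + γ x • w := by
  obtain ⟨α, hα⟩ := functional_of_plane P₁ hP₁
  obtain ⟨β, hβ⟩ := functional_of_plane P₂ hP₂
  obtain ⟨p, hp, hp1⟩ := exists_normalized P₁ P₂ hne hP₁ hP₂ β hβ
  obtain ⟨q, hq, hq1⟩ := exists_normalized P₂ P₁ hne.symm hP₂ hP₁ α hα
  rw [← hα, LinearMap.mem_ker] at hp
  rw [← hβ, LinearMap.mem_ker] at hq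
  have hw : ∃ w, α w = 0 ∧ β w = 0 ∧ w ≠ 0 := by
    have h1 := LinearMap.finrank_range_add_finrank_ker (α.prod β)
    have h2 := Submodule.finrank_le (LinearMap.range (α.prod β))
    simp only [Module.finrank_prod, Module.finrank_self, Module.finrank_fin_fun] at h1 h2
    have h3 : LinearMap.ker (α.prod β) ≠ ⊥ := by
      intro h
      rw [h, finrank_bot] at h1
      omega
    obtain ⟨w, hw, hw0⟩ := Submodule.exists_mem_ne_zero_of_ne_bot h3
    rw [LinearMap.mem_ker] at hw
    have hw' : (α w, β w) = 0 := hw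
    rw [Prod.mk_eq_zero] at hw'
    exact ⟨w, hw'.1, hw'.2, hw0⟩
  obtain ⟨w, hwα, hwβ, hw0⟩ := hw
  obtain ⟨k, hk⟩ := Function.ne_iff.1 hw0
  have hk' : w k ≠ 0 := hk
  let γ₀ : (Fin 3 → ZMod 7) →ₗ[ZMod 7] ZMod 7 := (w k)⁻¹ • LinearMap.proj k
  have hγ₀ : γ₀ w = 1 := by simp [γ₀, hk']
  let γ : (Fin 3 → ZMod 7) →ₗ[ZMod 7] ZMod 7 := γ₀ - γ₀ p • β - γ₀ q • α
  have hγ : ∀ x, γ x = γ₀ x - γ₀ p * β x - γ₀ q * α x := fun x => rfl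
  have hγq : γ q = 0 := by rw [hγ, hq, hq1]; ring
  have hγp : γ p = 0 := by rw [hγ, hp, hp1]; ring
  have hγw : γ w = 1 := by rw [hγ, hwα, hwβ, hγ₀]; ring
  refine ⟨α, β, γ, q, p, w, hα, hβ, hq1, hp, hwα, hq, hp1, hwβ, hγq, hγp, hγw, ?_⟩
  let Φ : (Fin 3 → ZMod 7) → (Fin 3 → ZMod 7) := fun c => c 0 • q + c 1 • p + c 2 • w
  have hΦα : ∀ c : Fin 3 → ZMod 7, α (Φ c) = c 0 := by intro c; simp [Φ, hq1, hp, hwα]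
  have hΦβ : ∀ c, β (Φ c) = c 1 := by intro c; simp [Φ, hq, hp1, hwβ]
  have hΦγ : ∀ c, γ (Φ c) = c 2 := by
    intro c; simp only [Φ, map_add, map_smul, hγq, hγp, hγw]; simp
  have hinj : Function.Injective Φ := by
    intro c c' h
    funext i
    fin_cases i
    · have := congrArg α h
      rwa [hΦα, hΦα] at this
    · have := congrArg β h
      rwa [hΦβ, hΦβ] at this
    · have := congrArg γ h
      rwa [hΦγ, hΦγ] at this
  intro x
  obtain ⟨c, rfl⟩ := Finite.injective_iff_surjective.1 hinj x
  rw [hΦα, hΦβ, hΦγ]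

theorem slopes (E : Finset (Fin 3 → ZMod 7)) (P : Submodule (ZMod 7) (Fin 3 → ZMod 7))
    (hd : {D : Submodule (ZMod 7) (Fin 3 → ZMod 7) |
      Module.finrank (ZMod 7) D = 1 ∧ D ≤ P ∧ Determines 7 E D}.ncard ≤ 2)
    (α β γ : (Fin 3 → ZMod 7) →ₗ[ZMod 7] ZMod 7) (p w : Fin 3 → ZMod 7)
    (hα : LinearMap.ker α = P) (hαp : α p = 0) (hαw : α w = 0) (hβp : β p = 1)
    (hβw : β w = 0) (hγp : γ p = 0) (hγw : γ w = 1)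
    (hdec : ∀ x, α x = 0 → x = β x • p + γ x • w) :
    ∃ s : Bool → ZMod 7,
      (∀ e ∈ E, ∀ e' ∈ E, α e = α e' → β e ≠ β e' →
        (γ e - γ e' = s false * (β e - β e') ∨ γ e - γ e' = s true * (β e - β e'))) ∧
      ((∃ e ∈ E, ∃ e' ∈ E, e ≠ e' ∧ α e = α e' ∧ β e = β e') → s false = s true) := by
  classical
  set 𝒟 := {D : Submodule (ZMod 7) (Fin 3 → ZMod 7) |
      Module.finrank (ZMod 7) D = 1 ∧ D ≤ P ∧ Determines 7 E D} with h𝒟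
  have : Finite (Submodule (ZMod 7) (Fin 3 → ZMod 7)) :=
    Finite.of_injective (fun D => (D : Set (Fin 3 → ZMod 7))) SetLike.coe_injective
  have hfin : 𝒟.Finite := Set.toFinite _
  let S : Finset (ZMod 7) := univ.filter (fun s => ∃ e ∈ E, ∃ e' ∈ E, α e = α e' ∧ β e ≠ β e' ∧
    γ e - γ e' = s * (β e - β e'))
  let D : ZMod 7 → Submodule (ZMod 7) (Fin 3 → ZMod 7) := fun s => Submodule.span (ZMod 7) {p + s • w}
  let D₀ : Submodule (ZMod 7) (Fin 3 → ZMod 7) := Submodule.span (ZMod 7) {w}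
  have hβD : ∀ s : ZMod 7, β (p + s • w) = 1 := by intro s; simp [hβp, hβw]
  have hγD : ∀ s : ZMod 7, γ (p + s • w) = s := by intro s; simp [hγp, hγw]
  have hD0 : ∀ s : ZMod 7, p + s • w ≠ 0 := by
    intro s h
    have := hβD s
    rw [h, map_zero] at this
    exact zero_ne_one this
  have hw0 : w ≠ 0 := by
    intro h
    rw [h, map_zero] at hγw
    exact zero_ne_one hγw
  have hinj : Function.Injective D := by
    intro s t h
    have h1 : p + s • w ∈ D t := by
      rw [← h]; exact Submodule.mem_span_singleton_self _
    obtain ⟨m, hm⟩ := Submodule.mem_span_singleton.1 h1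
    have h2 := congrArg β hm
    have h3 := congrArg γ hm
    rw [map_smul, hβD, hβD, smul_eq_mul, mul_one] at h2
    rw [map_smul, hγD, hγD, h2, one_smul] at h3
    exact h3.symm
  have hmem : ∀ s ∈ S, D s ∈ 𝒟 := by
    intro s hs
    obtain ⟨e, he, e', he', h1, h2, h3⟩ := (mem_filter.1 hs).2
    refine ⟨finrank_span_singleton (hD0 s), ?_, e, he, e', he', ?_, ?_⟩
    · rw [Submodule.span_singleton_le_iff_mem, ← hα, LinearMap.mem_ker]
      simp [hαp, hαw]
    · rintro rfl; exact h2 rfl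
    · refine Submodule.mem_span_singleton.2 ⟨β (e - e'), ?_⟩
      have h4 := hdec (e - e') (by rw [map_sub, h1, sub_self])
      have h5 : γ (e - e') = β (e - e') * s := by rw [map_sub, map_sub, h3, mul_comm]
      rw [smul_add, smul_smul, ← h5]
      exact h4.symm
  have hsub : ∀ s ∈ S.image D, s ∈ 𝒟 := by
    intro d hd'
    obtain ⟨s, hs, rfl⟩ := mem_image.1 hd'
    exact hmem s hs
  have hSmem : ∀ e ∈ E, ∀ e' ∈ E, α e = α e' → β e ≠ β e' →
      ∃ s ∈ S, γ e - γ e' = s * (β e - β e') := by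
    intro e he e' he' h1 h2
    have h3 : β e - β e' ≠ 0 := sub_ne_zero.2 h2
    have h4 : γ e - γ e' = ((γ e - γ e') * (β e - β e')⁻¹) * (β e - β e') := by
      rw [inv_mul_cancel_right₀ h3]
    exact ⟨_, mem_filter.2 ⟨mem_univ _, e, he, e', he', h1, h2, h4⟩, h4⟩
  by_cases hheavy : ∃ e ∈ E, ∃ e' ∈ E, e ≠ e' ∧ α e = α e' ∧ β e = β e'
  · obtain ⟨e, he, e', he', h1, h2, h3⟩ := hheavy
    have hD₀ : D₀ ∈ 𝒟 := by
      refine ⟨finrank_span_singleton hw0, ?_, e, he, e', he', h1, ?_⟩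
      · rw [Submodule.span_singleton_le_iff_mem, ← hα, LinearMap.mem_ker, hαw]
      · refine Submodule.mem_span_singleton.2 ⟨γ (e - e'), ?_⟩
        have h4 := hdec (e - e') (by rw [map_sub, h2, sub_self])
        rw [map_sub β, h3, sub_self, zero_smul, zero_add] at h4
        exact h4.symm
    have hnot : D₀ ∉ S.image D := by
      intro h
      obtain ⟨s, hs, h⟩ := mem_image.1 h
      have h1 : p + s • w ∈ D₀ := by
        rw [← h]; exact Submodule.mem_span_singleton_self _
      obtain ⟨m, hm⟩ := Submodule.mem_span_singleton.1 h1
      have h2 := congrArg β hm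
      rw [map_smul, hβD, hβw, smul_zero] at h2
      exact zero_ne_one h2
    have hc : (insert D₀ (S.image D)).card ≤ 2 := by
      rw [← Set.ncard_coe_finset]
      refine le_trans (Set.ncard_le_ncard ?_ hfin) hd
      intro d hd'
      rw [mem_coe, mem_insert] at hd'
      rcases hd' with rfl | hd'
      · exact hD₀
      · exact hsub d hd'
    rw [card_insert_of_notMem hnot, card_image_of_injective _ hinj] at hc
    obtain ⟨s, hs⟩ := card_le_one_iff_subset_singleton.1 (show S.card ≤ 1 by omega)
    refine ⟨fun _ => s, ?_, fun _ => rfl⟩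
    intro e he e' he' h1 h2
    obtain ⟨t, ht, h3⟩ := hSmem e he e' he' h1 h2
    left
    rw [h3, mem_singleton.1 (hs ht)]
  · have hc : (S.image D).card ≤ 2 := by
      rw [← Set.ncard_coe_finset]
      exact le_trans (Set.ncard_le_ncard (fun d hd' => hsub d (mem_coe.1 hd')) hfin) hd
    rw [card_image_of_injective _ hinj] at hc
    have hS : ∃ s0 s1, S ⊆ {s0, s1} := by
      rcases Nat.lt_or_ge S.card 2 with h | h
      · obtain ⟨s, hs⟩ := card_le_one_iff_subset_singleton.1 (show S.card ≤ 1 by omega)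
        exact ⟨s, s, by simpa using hs⟩
      · obtain ⟨x, y, _, hxy⟩ := card_eq_two.1 (le_antisymm hc h)
        exact ⟨x, y, hxy.subset⟩
    obtain ⟨s0, s1, hs⟩ := hS
    refine ⟨fun b => cond b s1 s0, ?_, fun h => absurd h hheavy⟩
    intro e he e' he' h1 h2
    obtain ⟨t, ht, h3⟩ := hSmem e he e' he' h1 h2
    have := hs ht
    rw [mem_insert, mem_singleton] at this
    rcases this with rfl | rfl
    · exact Or.inl h3
    · exact Or.inr h3

theorem uniform_slope {V : Type*} (E : Finset V) (i j g : V → ZMod 7) (s : Bool → ZMod 7)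
    (hinj : ∀ e ∈ E, ∀ e' ∈ E, i e = i e' → j e = j e' → e = e')
    (hs : ∀ e ∈ E, ∀ e' ∈ E, i e = i e' → j e ≠ j e' →
        (g e - g e' = s false * (j e - j e') ∨ g e - g e' = s true * (j e - j e'))) (c : ZMod 7) :
    ∃ b, ∀ e ∈ E, ∀ e' ∈ E, i e = c → i e' = c → g e - g e' = s b * (j e - j e') := by
  have hs' : ∀ e ∈ E, ∀ e' ∈ E, i e = c → i e' = c →
        (g e - g e' = s false * (j e - j e') ∨ g e - g e' = s true * (j e - j e')) := by
    intro e he e' he' h1 h2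
    by_cases h : j e = j e'
    · have := hinj e he e' he' (h1.trans h2.symm) h
      subst this
      left; simp
    · exact hs e he e' he' (h1.trans h2.symm) h
  by_cases h0 : ∀ e ∈ E, ∀ e' ∈ E, i e = c → i e' = c → g e - g e' = s false * (j e - j e')
  · exact ⟨false, h0⟩
  · push Not at h0
    obtain ⟨a, ha, b, hb, hac, hbc, hab⟩ := h0
    have hab' := (hs' a ha b hb hac hbc).resolve_left hab
    have key : ∀ e ∈ E, i e = c → g e - g a = s true * (j e - j a) := by
      intro e he hec
      rcases hs' e he a ha hec hac with h1 | h1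
      · rcases hs' e he b hb hec hbc with h2 | h2
        · exfalso
          apply hab
          linear_combination h2 - h1
        · linear_combination h2 - hab'
      · exact h1
    refine ⟨true, ?_⟩
    intro e he e' he' h1 h2
    linear_combination key e he h1 - key e' he' h2

theorem main_seven (E : Finset (Fin 3 → ZMod 7))
    (hcard : E.card = 21) (hspec : IsSpectral 7 E)
    (P₁ P₂ : Submodule (ZMod 7) (Fin 3 → ZMod 7)) (hne : P₁ ≠ P₂)
    (hP₁ : Module.finrank (ZMod 7) P₁ = 2) (hP₂ : Module.finrank (ZMod 7) P₂ = 2)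
    (hd₁ : {D : Submodule (ZMod 7) (Fin 3 → ZMod 7) |
      Module.finrank (ZMod 7) D = 1 ∧ D ≤ P₁ ∧ Determines 7 E D}.ncard ≤ 2)
    (hd₂ : {D : Submodule (ZMod 7) (Fin 3 → ZMod 7) |
      Module.finrank (ZMod 7) D = 1 ∧ D ≤ P₂ ∧ Determines 7 E D}.ncard ≤ 2) :
    ∃ d : Submodule (ZMod 7) (Fin 3 → ZMod 7), Module.finrank (ZMod 7) d = 1 ∧
      ∃ T : Finset (Fin 3 → ZMod 7), T.card = 7 ∧ ∀ e ∈ E, ∃ t ∈ T, e - t ∈ d := by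
  obtain ⟨α, β, γ, q, p, w, hα, hβ, hαq, hαp, hαw, hβq, hβp, hβw, hγq, hγp, hγw, hdec⟩ :=
    coords P₁ P₂ hne hP₁ hP₂
  have hplane : ∀ a b c t : ZMod 7, (a ≠ 0 ∨ b ≠ 0 ∨ c ≠ 0) →
      (E.filter (fun e => a * α e + b * β e + c * γ e = t)).card ≤ 7 := by
    intro a b c t h
    refine plane_le E hcard hspec (a • α + b • β + c • γ) ?_ t
    intro h0
    have h1 := LinearMap.congr_fun h0 q
    have h2 := LinearMap.congr_fun h0 p
    have h3 := LinearMap.congr_fun h0 w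
    simp [hαq, hβq, hγq] at h1
    simp [hαp, hβp, hγp] at h2
    simp [hαw, hβw, hγw] at h3
    tauto
  obtain ⟨s, hs, hs'⟩ := slopes E P₁ hd₁ α β γ p w hα hαp hαw hβp hβw hγp hγw (by
    intro x hx
    have := hdec x
    rw [hx, zero_smul, zero_add] at this
    exact this)
  obtain ⟨r, hr, hr'⟩ := slopes E P₂ hd₂ β α γ q w hβ hβq hβw hαq hαw hγq hγw (by
    intro x hx
    have := hdec x
    rw [hx, zero_smul, add_zero] at this
    exact this)
  by_cases hheavy : ∃ e ∈ E, ∃ e' ∈ E, e ≠ e' ∧ α e = α e' ∧ β e = β e'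
  · have hse := hs' hheavy
    have hre := hr' (by
      obtain ⟨e, he, e', he', h1, h2, h3⟩ := hheavy
      exact ⟨e, he, e', he', h1, h3, h2⟩)
    have hB := combB E hcard α β (fun e => γ e - s false * β e - r false * α e) hheavy
      (by
        intro c
        refine le_trans (card_le_card ?_) (hplane (- r false) (- s false) 1 c (by simp))
        intro e he
        rw [mem_filter] at he ⊢
        refine ⟨he.1, ?_⟩
        linear_combination he.2)
      (by
        intro a b c h
        refine le_trans (card_le_card ?_) (hplane a b 0 c (by tauto))
        intro e he
        rw [mem_filter] at he ⊢
        refine ⟨he.1, ?_⟩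
        linear_combination he.2)
      (by
        intro e _ e' _ h1 h2 h3
        have h4 : γ e = γ e' := by
          rw [h1, h2] at h3
          linear_combination h3
        rw [hdec e, hdec e', h1, h2, h4])
      (by
        intro e he e' he' h1 h2
        have h3 := hs e he e' he' h1 h2
        rw [← hse, or_self] at h3
        rw [h1]
        linear_combination h3)
      (by
        intro e he e' he' h1 h2
        have h3 := hr e he e' he' h1 h2
        rw [← hre, or_self] at h3
        rw [h1]
        linear_combination h3)
    have hw0 : w ≠ 0 := by
      intro h
      rw [h, map_zero] at hγw
      exact zero_ne_one hγw
    refine ⟨Submodule.span (ZMod 7) {w}, finrank_span_singleton hw0, ?_⟩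
    let T₀ : Finset (Fin 3 → ZMod 7) :=
      (E.image (fun e => (α e, β e))).image (fun ab : ZMod 7 × ZMod 7 => ab.1 • q + ab.2 • p)
    have hT₀ : T₀.card ≤ 7 := le_trans card_image_le hB
    obtain ⟨T, hT, hT7⟩ := exists_superset_card_eq hT₀ (by
      rw [Fintype.card_fun, ZMod.card, Fintype.card_fin]; norm_num)
    refine ⟨T, hT7, ?_⟩
    intro e he
    refine ⟨α e • q + β e • p, hT (mem_image_of_mem _ (mem_image_of_mem (fun e => (α e, β e)) he)), ?_⟩
    refine Submodule.mem_span_singleton.2 ⟨γ e, ?_⟩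
    have := hdec e
    rw [eq_sub_iff_add_eq, add_comm]
    exact this.symm
  · exfalso
    have hinj : ∀ e ∈ E, ∀ e' ∈ E, α e = α e' → β e = β e' → e = e' := by
      intro e he e' he' h1 h2
      by_contra h
      exact hheavy ⟨e, he, e', he', h, h1, h2⟩
    choose ρ hρ using uniform_slope E α β γ s hinj hs
    choose κ hκ using uniform_slope E β α γ r (fun e he e' he' h1 h2 => hinj e he e' he' h2 h1) hr
    refine combA E hcard α β ρ κ (fun e => ((ρ (α e), κ (β e), γ e - s (ρ (α e)) * β e - r (κ (β e)) * α e) :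
      Bool × Bool × ZMod 7)) hinj ?_ ?_ ?_ ?_ ?_ ?_
    · intro e _ e' _ h
      simp only [Prod.mk.injEq] at h
      exact ⟨h.1, h.2.1⟩
    · intro e he e' he' h1 h2
      have h3 := hρ (α e') e he e' he' h1 rfl
      simp only [Prod.mk.injEq]
      refine ⟨by rw [h1], h2, ?_⟩
      rw [h2, h1]
      linear_combination h3
    · intro e he e' he' h1 h2
      have h3 := hκ (β e') e he e' he' h1 rfl
      simp only [Prod.mk.injEq]
      refine ⟨h2, by rw [h1], ?_⟩
      rw [h2, h1]
      linear_combination h3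
    · intro c
      refine le_trans (card_le_card ?_) (hplane 1 0 0 c (by simp))
      intro e he
      rw [mem_filter] at he ⊢
      refine ⟨he.1, ?_⟩
      linear_combination he.2
    · intro c
      refine le_trans (card_le_card ?_) (hplane 0 1 0 c (by simp))
      intro e he
      rw [mem_filter] at he ⊢
      refine ⟨he.1, ?_⟩
      linear_combination he.2
    · rintro ⟨b1, b2, t⟩
      refine le_trans (card_le_card ?_) (hplane (- r b2) (- s b1) 1 t (by simp))
      intro e he
      rw [mem_filter] at he ⊢
      refine ⟨he.1, ?_⟩
      obtain ⟨he, e', he', h⟩ := he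
      rw [mem_filter] at he'
      obtain ⟨he', hk⟩ := he'
      simp only [Prod.mk.injEq] at hk
      obtain ⟨h1, h2, h3⟩ := hk
      rw [h1, h2] at h3
      rcases h with h | h
      · have h4 := hρ (α e') e he e' he' h rfl
        rw [h1] at h4
        rw [h]
        linear_combination h3 + h4
      · have h4 := hκ (β e') e he e' he' h rfl
        rw [h2] at h4
        rw [h]
        linear_combination h3 + h4

end field

/-- If `E ⊆ 𝔽_7^3` is a spectral set of size `21` that determines at most two
of the one-dimensional subspaces contained in each of two distinct
two-dimensional subspaces `P₁, P₂`, then `E` is contained in the union of seven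
parallel lines. -/
theorem spectral_21_in_seven_parallel_lines (E : Finset (Fin 3 → ZMod 7))
    (hcard : E.card = 21) (hspec : IsSpectral 7 E)
    (P₁ P₂ : Submodule (ZMod 7) (Fin 3 → ZMod 7)) (hne : P₁ ≠ P₂)
    (hP₁ : Module.finrank (ZMod 7) P₁ = 2) (hP₂ : Module.finrank (ZMod 7) P₂ = 2)
    (hd₁ : {D : Submodule (ZMod 7) (Fin 3 → ZMod 7) |
      Module.finrank (ZMod 7) D = 1 ∧ D ≤ P₁ ∧ Determines 7 E D}.ncard ≤ 2)
    (hd₂ : {D : Submodule (ZMod 7) (Fin 3 → ZMod 7) |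
      Module.finrank (ZMod 7) D = 1 ∧ D ≤ P₂ ∧ Determines 7 E D}.ncard ≤ 2) :
    ∃ d : Submodule (ZMod 7) (Fin 3 → ZMod 7), Module.finrank (ZMod 7) d = 1 ∧
      ∃ T : Finset (Fin 3 → ZMod 7), T.card = 7 ∧ ∀ e ∈ E, ∃ t ∈ T, e - t ∈ d := by
  exact main_seven E hcard hspec P₁ P₂ hne hP₁ hP₂ hd₁ hd₂
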